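/- Let φ = (φ₁, φ₂, φ₃) be a smooth periodic divergence-free vector field on Ω = M × (-1,1) with ∫_Ω φ = 0 and φ₃|_{z=0} = 0, let φ_H = (φ₁, φ₂), and let φ, ψ be smooth periodic functions with ∇φ ∈ H¹(Ω), ψ ∈ L²(Ω). Then |∫_Ω (φ·∇φ) ψ| ≤ C ‖∇φ_H‖₂^{1/2} ‖Δφ_H‖₂^{1/2} ‖∇φ‖₂^{1/2} ‖Δφ‖₂^{1/2} ‖ψ‖₂, where C depends only on L₁ and L₂. -/

import Mathlib

open MeasureTheory Real Set

noncomputable section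

abbrev Pt := ℝ × ℝ × ℝ

/-- partial derivative in `x`. -/
def pdx (f : Pt → ℝ) (p : Pt) : ℝ := deriv (fun t => f (t, p.2.1, p.2.2)) p.1
/-- partial derivative in `y`. -/
def pdy (f : Pt → ℝ) (p : Pt) : ℝ := deriv (fun t => f (p.1, t, p.2.2)) p.2.1
/-- partial derivative in `z`. -/
def pdz (f : Pt → ℝ) (p : Pt) : ℝ := deriv (fun t => f (p.1, p.2.1, t)) p.2.2

/-- full Laplacian. -/
def lap (f : Pt → ℝ) : Pt → ℝ := fun p => pdx (pdx f) p + pdy (pdy f) p + pdz (pdz f) p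
/-- horizontal Laplacian. -/
def lapH (f : Pt → ℝ) : Pt → ℝ := fun p => pdx (pdx f) p + pdy (pdy f) p

/-- squared full gradient. -/
def gradSq (f : Pt → ℝ) (p : Pt) : ℝ := (pdx f p)^2 + (pdy f p)^2 + (pdz f p)^2
/-- squared horizontal gradient. -/
def gradHSq (f : Pt → ℝ) (p : Pt) : ℝ := (pdx f p)^2 + (pdy f p)^2

/-- the horizontal domain `M = (0,L₁) × (0,L₂)`. -/
def MSet (L1 L2 : ℝ) : Set (ℝ × ℝ) := Ioo 0 L1 ×ˢ Ioo 0 L2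
/-- the domain `Ω = M × (-1,1)`. -/
def OmegaSet (L1 L2 : ℝ) : Set Pt := Ioo 0 L1 ×ˢ (Ioo 0 L2 ×ˢ Ioo (-1 : ℝ) 1)

/-- integral over `Ω`. -/
def intOn (L1 L2 : ℝ) (G : Pt → ℝ) : ℝ := ∫ p in OmegaSet L1 L2, G p

/-- periodicity in `x`, `y`, `z` with periods `L₁`, `L₂`, `2`. -/
def Periodic3 (L1 L2 : ℝ) (f : Pt → ℝ) : Prop :=
  (∀ p : Pt, f (p.1 + L1, p.2.1, p.2.2) = f p) ∧
  (∀ p : Pt, f (p.1, p.2.1 + L2, p.2.2) = f p) ∧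
  (∀ p : Pt, f (p.1, p.2.1, p.2.2 + 2) = f p)

/-- squared `L²(Ω)` norm. -/
def L2sq (L1 L2 : ℝ) (F : Pt → ℝ) : ℝ := intOn L1 L2 (fun p => (F p)^2)
/-- `L²(Ω)` norm. -/
def L2n (L1 L2 : ℝ) (F : Pt → ℝ) : ℝ := Real.sqrt (L2sq L1 L2 F)
/-- `L²(Ω)` norm of the horizontal gradient. -/
def L2gradH (L1 L2 : ℝ) (F : Pt → ℝ) : ℝ := Real.sqrt (intOn L1 L2 (gradHSq F))
/-- `L²(Ω)` norm of the full gradient. -/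
def L2grad (L1 L2 : ℝ) (F : Pt → ℝ) : ℝ := Real.sqrt (intOn L1 L2 (gradSq F))

/-- first component of a horizontal vector field. -/
def c1 (v : Pt → ℝ × ℝ) : Pt → ℝ := fun p => (v p).1
/-- second component of a horizontal vector field. -/
def c2 (v : Pt → ℝ × ℝ) : Pt → ℝ := fun p => (v p).2

/-- horizontal divergence. -/
def divH (v : Pt → ℝ × ℝ) : Pt → ℝ := fun p => pdx (c1 v) p + pdy (c2 v) p

/-- squared `L²(Ω)` norm of a horizontal vector field. -/
def vL2sq (L1 L2 : ℝ) (v : Pt → ℝ × ℝ) : ℝ := L2sq L1 L2 (c1 v) + L2sq L1 L2 (c2 v)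
def vL2n (L1 L2 : ℝ) (v : Pt → ℝ × ℝ) : ℝ := Real.sqrt (vL2sq L1 L2 v)
/-- squared `L²(Ω)` norm of the full gradient of a horizontal vector field. -/
def vGradSq (L1 L2 : ℝ) (v : Pt → ℝ × ℝ) : ℝ :=
  intOn L1 L2 (fun p => gradSq (c1 v) p + gradSq (c2 v) p)
def vGradn (L1 L2 : ℝ) (v : Pt → ℝ × ℝ) : ℝ := Real.sqrt (vGradSq L1 L2 v)
/-- squared `L²(Ω)` norm of the Laplacian of a horizontal vector field. -/
def vLapSq (L1 L2 : ℝ) (v : Pt → ℝ × ℝ) : ℝ :=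
  intOn L1 L2 (fun p => (lap (c1 v) p)^2 + (lap (c2 v) p)^2)
def vLapn (L1 L2 : ℝ) (v : Pt → ℝ × ℝ) : ℝ := Real.sqrt (vLapSq L1 L2 v)
/-- periodicity of a horizontal vector field. -/
def vPeriodic (L1 L2 : ℝ) (v : Pt → ℝ × ℝ) : Prop :=
  Periodic3 L1 L2 (c1 v) ∧ Periodic3 L1 L2 (c2 v)

/-- The point obtained from `p` by replacing its `i`-th coordinate by `t`. -/
def slide (i : Fin 3) (p : Pt) (t : ℝ) : Pt :=
  match i with
  | 0 => (t, p.2.1, p.2.2)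
  | 1 => (p.1, t, p.2.2)
  | 2 => (p.1, p.2.1, t)

/-- The `i`-th coordinate of `p`. -/
def coord (i : Fin 3) (p : Pt) : ℝ :=
  match i with
  | 0 => p.1
  | 1 => p.2.1
  | 2 => p.2.2

/-- The `i`-th standard basis vector. -/
def axis (i : Fin 3) : Pt :=
  match i with
  | 0 => (1, 0, 0)
  | 1 => (0, 1, 0)
  | 2 => (0, 0, 1)

/-- Lower endpoint of the `i`-th side of `Ω`. -/
def lower (i : Fin 3) : ℝ :=
  match i with
  | 0 => 0
  | 1 => 0
  | 2 => -1

/-- Upper endpoint of the `i`-th side of `Ω`. -/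
def upper (L1 L2 : ℝ) (i : Fin 3) : ℝ :=
  match i with
  | 0 => L1
  | 1 => L2
  | 2 => 1

/-- Length of the `i`-th side of `Ω`. -/
def sideLen (L1 L2 : ℝ) (i : Fin 3) : ℝ := upper L1 L2 i - lower i

/-- Partial derivative in the `i`-th coordinate. -/
def pd (i : Fin 3) (f : Pt → ℝ) (p : Pt) : ℝ := deriv (fun t => f (slide i p t)) (coord i p)

/-- Integral of `f` over the segment of `Ω` through `p` in the `i`-th direction. -/
def lineInt (L1 L2 : ℝ) (i : Fin 3) (f : Pt → ℝ) (p : Pt) : ℝ :=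
  ∫ t in lower i..upper L1 L2 i, f (slide i p t)

/-- The box `[0,L₁] × [0,L₂] × [-1,1]`. -/
def closedBox (L1 L2 : ℝ) : Set Pt := {p | ∀ i, coord i p ∈ Icc (lower i) (upper L1 L2 i)}

/-- Invariance under translation by the sides of `Ω`. -/
def SidePeriodic (L1 L2 : ℝ) (f : Pt → ℝ) : Prop :=
  ∀ i p, f (p + sideLen L1 L2 i • axis i) = f p

theorem pd_zero (f : Pt → ℝ) : pd 0 f = pdx f := rfl
theorem pd_one (f : Pt → ℝ) : pd 1 f = pdy f := rfl
theorem pd_two (f : Pt → ℝ) : pd 2 f = pdz f := rfl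

theorem coord_slide (i : Fin 3) (p : Pt) (t : ℝ) : coord i (slide i p t) = t := by
  fin_cases i <;> rfl

theorem coord_slide_ne {i j : Fin 3} (h : j ≠ i) (p : Pt) (t : ℝ) :
    coord j (slide i p t) = coord j p := by
  fin_cases i <;> fin_cases j <;> first | rfl | exact absurd rfl h

theorem slide_coord (i : Fin 3) (p : Pt) : slide i p (coord i p) = p := by
  fin_cases i <;> rfl

theorem slide_eq_add (i : Fin 3) (p : Pt) (t : ℝ) : slide i p t = p + (t - coord i p) • axis i := by
  fin_cases i <;> simp [slide, coord, axis, Prod.ext_iff]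

theorem slide_mem_closedBox {L1 L2 : ℝ} {i : Fin 3} {p : Pt} {t : ℝ} (hp : p ∈ closedBox L1 L2)
    (ht : t ∈ Icc (lower i) (upper L1 L2 i)) : slide i p t ∈ closedBox L1 L2 := by
  intro j
  by_cases h : j = i
  · subst h; rwa [coord_slide]
  · rw [coord_slide_ne h]; exact hp j

theorem omegaSet_subset_closedBox (L1 L2 : ℝ) : OmegaSet L1 L2 ⊆ closedBox L1 L2 := by
  rintro ⟨x, y, z⟩ ⟨hx, hy, hz⟩ i
  fin_cases i
  exacts [Ioo_subset_Icc_self hx, Ioo_subset_Icc_self hy, Ioo_subset_Icc_self hz]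

@[fun_prop]
theorem continuous_slide_uncurry (i : Fin 3) : Continuous fun q : Pt × ℝ => slide i q.1 q.2 := by
  fin_cases i <;> simp only [slide] <;> fun_prop

theorem continuous_comp_slide {f : Pt → ℝ} (hf : Continuous f) (i : Fin 3) (p : Pt) :
    Continuous fun t => f (slide i p t) :=
  hf.comp ((continuous_slide_uncurry i).comp (by fun_prop : Continuous fun t : ℝ => (p, t)))

theorem hasDerivAt_slide (i : Fin 3) (p : Pt) (t : ℝ) : HasDerivAt (slide i p) (axis i) t := by
  have : slide i p = fun t => p + (t - coord i p) • axis i := funext (slide_eq_add i p)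
  rw [this]
  simpa using (((hasDerivAt_id t).sub_const (coord i p)).smul_const (axis i)).const_add p

theorem pd_eq_fderiv {f : Pt → ℝ} (hf : ContDiff ℝ (⊤ : ℕ∞) f) (i : Fin 3) :
    pd i f = fun p => fderiv ℝ f p (axis i) := by
  funext p
  have h := (hf.differentiable (by simp) (slide i p (coord i p))).hasFDerivAt.comp_hasDerivAt
    (coord i p) (hasDerivAt_slide i p (coord i p))
  rw [slide_coord] at h
  exact h.deriv

theorem contDiff_pd {f : Pt → ℝ} (hf : ContDiff ℝ (⊤ : ℕ∞) f) (i : Fin 3) :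
    ContDiff ℝ (⊤ : ℕ∞) (pd i f) := by
  rw [pd_eq_fderiv hf]
  exact (hf.fderiv_right (by simp)).clm_apply contDiff_const

theorem hasDerivAt_comp_slide {f : Pt → ℝ} (hf : ContDiff ℝ (⊤ : ℕ∞) f) (i : Fin 3) (p : Pt)
    (t : ℝ) : HasDerivAt (fun t => f (slide i p t)) (pd i f (slide i p t)) t := by
  rw [pd_eq_fderiv hf]
  exact (hf.differentiable (by simp) (slide i p t)).hasFDerivAt.comp_hasDerivAt t
    (hasDerivAt_slide i p t)

theorem pd_comm {f : Pt → ℝ} (hf : ContDiff ℝ (⊤ : ℕ∞) f) (i j : Fin 3) :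
    pd i (pd j f) = pd j (pd i f) := by
  have key : ∀ i j : Fin 3, ∀ p, pd i (pd j f) p = fderiv ℝ (fderiv ℝ f) p (axis i) (axis j) := by
    intro i j p
    rw [pd_eq_fderiv (contDiff_pd hf j), pd_eq_fderiv hf j]
    have hd : DifferentiableAt ℝ (fderiv ℝ f) p :=
      (hf.fderiv_right (m := (⊤ : ℕ∞)) (by simp)).differentiable (by simp) p
    simp [fderiv_clm_apply hd (differentiableAt_const (axis j))]
  funext p
  rw [key, key]
  exact (hf.contDiffAt.isSymmSndFDerivAt (by
    rw [minSmoothness_of_isRCLikeNormedField]; exact WithTop.coe_le_coe.2 (le_top (a := (2 : ℕ∞))))).eq _ _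

theorem pd_mul {f g : Pt → ℝ} (hf : ContDiff ℝ (⊤ : ℕ∞) f) (hg : ContDiff ℝ (⊤ : ℕ∞) g)
    (i : Fin 3) (p : Pt) :
    pd i (fun q => f q * g q) p = pd i f p * g p + f p * pd i g p := by
  have h := (hasDerivAt_comp_slide hf i p (coord i p)).fun_mul
    (hasDerivAt_comp_slide hg i p (coord i p))
  simp only [slide_coord] at h
  exact h.deriv

theorem SidePeriodic.pd {L1 L2 : ℝ} {f : Pt → ℝ} (hf : ContDiff ℝ (⊤ : ℕ∞) f)
    (hp : SidePeriodic L1 L2 f) (i : Fin 3) : SidePeriodic L1 L2 (pd i f) := by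
  intro j p
  rw [pd_eq_fderiv hf]
  simp only
  rw [← fderiv_comp_add_right, funext (hp j)]

theorem SidePeriodic.mul {L1 L2 : ℝ} {f g : Pt → ℝ} (hf : SidePeriodic L1 L2 f)
    (hg : SidePeriodic L1 L2 g) : SidePeriodic L1 L2 (fun p => f p * g p) := by
  intro i p
  simp only [hf i p, hg i p]

theorem Periodic3.sidePeriodic {L1 L2 : ℝ} {f : Pt → ℝ} (h : Periodic3 L1 L2 f) :
    SidePeriodic L1 L2 f := by
  rintro i ⟨x, y, z⟩
  fin_cases i
  · simpa [sideLen, upper, lower, axis] using h.1 (x, y, z)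
  · simpa [sideLen, upper, lower, axis] using h.2.1 (x, y, z)
  · have := h.2.2 (x, y, z)
    norm_num [sideLen, upper, lower, axis] at this ⊢
    exact this

theorem SidePeriodic.slide_upper {L1 L2 : ℝ} {f : Pt → ℝ} (hf : SidePeriodic L1 L2 f)
    (i : Fin 3) (p : Pt) : f (slide i p (upper L1 L2 i)) = f (slide i p (lower i)) := by
  rw [← hf i (slide i p (lower i))]
  congr 1
  rw [slide_eq_add i p, slide_eq_add i p, add_assoc, ← add_smul, sideLen]
  congr 2
  ring

theorem lineInt_pd {L1 L2 : ℝ} {f : Pt → ℝ} (hf : ContDiff ℝ (⊤ : ℕ∞) f)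
    (hp : SidePeriodic L1 L2 f) (i : Fin 3) (p : Pt) : lineInt L1 L2 i (pd i f) p = 0 := by
  rw [lineInt, intervalIntegral.integral_eq_sub_of_hasDerivAt
    (fun t _ => hasDerivAt_comp_slide hf i p t)
    ((continuous_comp_slide (contDiff_pd hf i).continuous i p).intervalIntegrable _ _),
    hp.slide_upper, sub_self]

theorem lower_lt_upper {L1 L2 : ℝ} (hL1 : 0 < L1) (hL2 : 0 < L2) (i : Fin 3) :
    lower i < upper L1 L2 i := by
  fin_cases i
  · exact hL1
  · exact hL2
  · norm_num [lower, upper]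

theorem sideLen_pos {L1 L2 : ℝ} (hL1 : 0 < L1) (hL2 : 0 < L2) (i : Fin 3) :
    0 < sideLen L1 L2 i := sub_pos.2 (lower_lt_upper hL1 hL2 i)

theorem continuous_lineInt {f : Pt → ℝ} (hf : Continuous f) (L1 L2 : ℝ) (i : Fin 3) :
    Continuous (lineInt L1 L2 i f) :=
  intervalIntegral.continuous_parametric_intervalIntegral_of_continuous'
    (f := fun p t => f (slide i p t)) (hf.comp (continuous_slide_uncurry i)) _ _

theorem abs_integral_le_integral_abs_of_mem {g : ℝ → ℝ} {a b s t : ℝ} (hg : Continuous g)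
    (hs : s ∈ Icc a b) (ht : t ∈ Icc a b) : |∫ r in s..t, g r| ≤ ∫ r in a..b, |g r| := by
  have hab : a ≤ b := hs.1.trans hs.2
  refine (intervalIntegral.norm_integral_le_integral_norm_uIoc (f := g)).trans ?_
  rw [intervalIntegral.integral_of_le hab]
  refine setIntegral_mono_set (hg.abs.integrableOn_Ioc) (Filter.Eventually.of_forall fun _ =>
    abs_nonneg _) ?_
  exact (Ioc_subset_Ioc (le_min hs.1 ht.1) (max_le hs.2 ht.2)).eventuallyLE

/-- A continuously differentiable function on an interval is close to its mean. -/
theorem abs_mul_sub_integral_le {f f' : ℝ → ℝ} {a b t : ℝ} (hab : a ≤ b)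
    (hf : ∀ s, HasDerivAt f (f' s) s) (hf' : Continuous f') (ht : t ∈ Icc a b) :
    |(b - a) * f t - ∫ s in a..b, f s| ≤ (b - a) * ∫ s in a..b, |f' s| := by
  have hc : Continuous f := continuous_iff_continuousAt.2 fun s => (hf s).continuousAt
  have hpt : ∀ s ∈ Icc a b, |f t - f s| ≤ ∫ r in a..b, |f' r| := by
    intro s hs
    rw [← intervalIntegral.integral_eq_sub_of_hasDerivAt (fun x _ => hf x)
      (hf'.intervalIntegrable s t)]
    exact abs_integral_le_integral_abs_of_mem hf' hs ht
  have h1 : (b - a) * f t - ∫ s in a..b, f s = ∫ s in a..b, (f t - f s) := by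
    rw [intervalIntegral.integral_sub (by simp) (hc.intervalIntegrable _ _)]
    simp
  rw [h1]
  have := intervalIntegral.norm_integral_le_of_norm_le_const (a := a) (b := b)
    (f := fun s => f t - f s) (C := ∫ r in a..b, |f' r|) (fun s hs => hpt s (by
      rw [uIoc_of_le hab] at hs; exact Ioc_subset_Icc_self hs))
  rwa [abs_of_nonneg (sub_nonneg.2 hab), mul_comm] at this

theorem sq_integral_mul_le {α : Type*} [MeasurableSpace α] {μ : Measure α} {f g : α → ℝ}
    (hf : Integrable (fun x => f x ^ 2) μ) (hg : Integrable (fun x => g x ^ 2) μ)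
    (hfg : Integrable (fun x => f x * g x) μ) :
    (∫ x, f x * g x ∂μ) ^ 2 ≤ (∫ x, f x ^ 2 ∂μ) * ∫ x, g x ^ 2 ∂μ := by
  have h : ∀ t : ℝ, 0 ≤ (∫ x, f x ^ 2 ∂μ) * (t * t) + (2 * ∫ x, f x * g x ∂μ) * t
      + ∫ x, g x ^ 2 ∂μ := by
    intro t
    have h0 : 0 ≤ ∫ x, (t * f x + g x) ^ 2 ∂μ := integral_nonneg fun x => sq_nonneg _
    have h1 : ∀ x, (t * f x + g x) ^ 2 = (t * t) * f x ^ 2 + (2 * t) * (f x * g x) + g x ^ 2 :=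
      fun x => by ring
    simp_rw [h1] at h0
    have h2 : Integrable (fun x => (t * t) * f x ^ 2 + (2 * t) * (f x * g x)) μ :=
      (hf.const_mul _).add (hfg.const_mul _)
    rw [integral_add h2 hg,
      integral_add (hf.const_mul _) (hfg.const_mul _), integral_const_mul, integral_const_mul] at h0
    linarith
  have := discrim_le_zero h
  rw [discrim] at this
  nlinarith

theorem lineInt_mono {L1 L2 : ℝ} (hL1 : 0 < L1) (hL2 : 0 < L2) {f g : Pt → ℝ}
    (hf : Continuous f) (hg : Continuous g) (h : ∀ p ∈ closedBox L1 L2, f p ≤ g p) (i : Fin 3)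
    {p : Pt} (hp : p ∈ closedBox L1 L2) : lineInt L1 L2 i f p ≤ lineInt L1 L2 i g p :=
  intervalIntegral.integral_mono_on (lower_lt_upper hL1 hL2 i).le
    ((continuous_comp_slide hf i p).intervalIntegrable _ _)
    ((continuous_comp_slide hg i p).intervalIntegrable _ _)
    fun _ ht => h _ (slide_mem_closedBox hp ht)

theorem lineInt_nonneg {L1 L2 : ℝ} (hL1 : 0 < L1) (hL2 : 0 < L2) {f : Pt → ℝ}
    (h : ∀ p, 0 ≤ f p) (i : Fin 3) (p : Pt) : 0 ≤ lineInt L1 L2 i f p :=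
  intervalIntegral.integral_nonneg (lower_lt_upper hL1 hL2 i).le fun _ _ => h _

theorem lineInt_add {f g : Pt → ℝ} (hf : Continuous f) (hg : Continuous g) (L1 L2 : ℝ)
    (i : Fin 3) (p : Pt) :
    lineInt L1 L2 i (fun q => f q + g q) p = lineInt L1 L2 i f p + lineInt L1 L2 i g p :=
  intervalIntegral.integral_add ((continuous_comp_slide hf i p).intervalIntegrable _ _)
    ((continuous_comp_slide hg i p).intervalIntegrable _ _)

theorem lineInt_const_mul (f : Pt → ℝ) (L1 L2 c : ℝ) (i : Fin 3) (p : Pt) :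
    lineInt L1 L2 i (fun q => c * f q) p = c * lineInt L1 L2 i f p :=
  intervalIntegral.integral_const_mul _ _

theorem sq_lineInt_le {L1 L2 : ℝ} (hL1 : 0 < L1) (hL2 : 0 < L2) {f : Pt → ℝ}
    (hf : Continuous f) (i : Fin 3) (p : Pt) :
    lineInt L1 L2 i f p ^ 2 ≤ sideLen L1 L2 i * lineInt L1 L2 i (fun q => f q ^ 2) p := by
  have hc := continuous_comp_slide hf i p
  have h := sq_integral_mul_le (μ := volume.restrict (Ioc (lower i) (upper L1 L2 i)))
    (f := fun _ => 1) (g := fun t => f (slide i p t)) (by simp)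
    (hc.pow 2).integrableOn_Ioc (by simp only [one_mul]; exact hc.integrableOn_Ioc)
  have hle := (lower_lt_upper hL1 hL2 i).le
  simpa [lineInt, intervalIntegral.integral_of_le hle, sideLen, hle] using h

theorem abs_sideLen_mul_sub_lineInt_le {L1 L2 : ℝ} (hL1 : 0 < L1) (hL2 : 0 < L2) {f : Pt → ℝ}
    (hf : ContDiff ℝ (⊤ : ℕ∞) f) (i : Fin 3) {p : Pt} (hp : p ∈ closedBox L1 L2) :
    |sideLen L1 L2 i * f p - lineInt L1 L2 i f p|
      ≤ sideLen L1 L2 i * lineInt L1 L2 i (fun q => |pd i f q|) p := by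
  have h := abs_mul_sub_integral_le (lower_lt_upper hL1 hL2 i).le
    (hasDerivAt_comp_slide hf i p) (continuous_comp_slide (contDiff_pd hf i).continuous i p) (hp i)
  rwa [slide_coord] at h

theorem sq_sideLen_mul_sub_lineInt_le {L1 L2 : ℝ} (hL1 : 0 < L1) (hL2 : 0 < L2) {f : Pt → ℝ}
    (hf : ContDiff ℝ (⊤ : ℕ∞) f) (i : Fin 3) {p : Pt} (hp : p ∈ closedBox L1 L2) :
    (sideLen L1 L2 i * f p - lineInt L1 L2 i f p) ^ 2
      ≤ sideLen L1 L2 i ^ 3 * lineInt L1 L2 i (fun q => pd i f q ^ 2) p := by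
  have h1 := abs_sideLen_mul_sub_lineInt_le hL1 hL2 hf i hp
  have h2 := sq_lineInt_le hL1 hL2 (contDiff_pd hf i).continuous.abs i p
  simp only [sq_abs] at h2
  calc _ ≤ (sideLen L1 L2 i * lineInt L1 L2 i (fun q => |pd i f q|) p) ^ 2 :=
        sq_le_sq.2 (h1.trans (le_abs_self _))
    _ = sideLen L1 L2 i ^ 2 * lineInt L1 L2 i (fun q => |pd i f q|) p ^ 2 := by ring
    _ ≤ sideLen L1 L2 i ^ 2 * (sideLen L1 L2 i * lineInt L1 L2 i (fun q => pd i f q ^ 2) p) := by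
        gcongr
    _ = _ := by ring

/-- Density whose line integrals dominate the square of `f`. -/
def supDensity (L1 L2 : ℝ) (i : Fin 3) (f : Pt → ℝ) (p : Pt) : ℝ :=
  f p ^ 2 / sideLen L1 L2 i + 2 * (|f p| * |pd i f p|)

theorem continuous_supDensity {f : Pt → ℝ} (hf : ContDiff ℝ (⊤ : ℕ∞) f) (L1 L2 : ℝ) (i : Fin 3) :
    Continuous (supDensity L1 L2 i f) := by
  have h1 := hf.continuous
  have h2 := (contDiff_pd hf i).continuous
  unfold supDensity
  fun_prop

theorem supDensity_nonneg {L1 L2 : ℝ} (hL1 : 0 < L1) (hL2 : 0 < L2) (i : Fin 3) (f : Pt → ℝ)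
    (p : Pt) : 0 ≤ supDensity L1 L2 i f p := by
  have := sideLen_pos hL1 hL2 i
  unfold supDensity
  positivity

theorem sq_le_lineInt_supDensity {L1 L2 : ℝ} (hL1 : 0 < L1) (hL2 : 0 < L2) {f : Pt → ℝ}
    (hf : ContDiff ℝ (⊤ : ℕ∞) f) (i : Fin 3) {p : Pt} (hp : p ∈ closedBox L1 L2) :
    f p ^ 2 ≤ lineInt L1 L2 i (supDensity L1 L2 i f) p := by
  have hl := sideLen_pos hL1 hL2 i
  have hc := hf.continuous
  have hc' := (contDiff_pd hf i).continuous
  have h := (abs_le.1 (abs_sideLen_mul_sub_lineInt_le hL1 hL2 (hf.mul hf) i hp)).2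
  have h2 : ∀ q, |pd i (fun q => f q * f q) q| = 2 * (|f q| * |pd i f q|) := by
    intro q
    rw [pd_mul hf hf, ← abs_mul, ← abs_two, ← abs_mul]
    congr 1
    ring
  change sideLen L1 L2 i * (f p * f p) - lineInt L1 L2 i (fun q => f q * f q) p ≤
    sideLen L1 L2 i * lineInt L1 L2 i (fun q => |pd i (fun q => f q * f q) q|) p at h
  simp only [h2] at h
  have h3 : supDensity L1 L2 i f = fun q => (sideLen L1 L2 i)⁻¹ * (f q * f q) +
      2 * (|f q| * |pd i f q|) := by
    funext q
    rw [supDensity]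
    ring
  rw [h3, lineInt_add (by fun_prop) (by fun_prop), lineInt_const_mul]
  have h4 := mul_le_mul_of_nonneg_left h (inv_nonneg.2 hl.le)
  rw [mul_sub, inv_mul_cancel_left₀ hl.ne', inv_mul_cancel_left₀ hl.ne'] at h4
  nlinarith

/-! ### Integration over `Ω` -/

theorem restrict_omegaSet (L1 L2 : ℝ) : (volume : Measure Pt).restrict (OmegaSet L1 L2) =
    (volume.restrict (Ioo 0 L1)).prod
      ((volume.restrict (Ioo 0 L2)).prod (volume.restrict (Ioo (-1 : ℝ) 1))) := by
  rw [Measure.prod_restrict, Measure.prod_restrict]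
  rfl

theorem integrableOn_omegaSet {f : Pt → ℝ} (hf : Continuous f) (L1 L2 : ℝ) :
    IntegrableOn f (OmegaSet L1 L2) := by
  refine (hf.continuousOn.integrableOn_compact
    ((isCompact_Icc (a := (0 : ℝ)) (b := L1)).prod
      ((isCompact_Icc (a := (0 : ℝ)) (b := L2)).prod
        (isCompact_Icc (a := (-1 : ℝ)) (b := 1))))).mono_set ?_
  exact prod_mono Ioo_subset_Icc_self (prod_mono Ioo_subset_Icc_self Ioo_subset_Icc_self)

theorem measurableSet_omegaSet (L1 L2 : ℝ) : MeasurableSet (OmegaSet L1 L2) :=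
  measurableSet_Ioo.prod (measurableSet_Ioo.prod measurableSet_Ioo)

theorem intOn_mono {L1 L2 : ℝ} {f g : Pt → ℝ} (hf : Continuous f) (hg : Continuous g)
    (h : ∀ p ∈ closedBox L1 L2, f p ≤ g p) : intOn L1 L2 f ≤ intOn L1 L2 g :=
  setIntegral_mono_on (integrableOn_omegaSet hf _ _) (integrableOn_omegaSet hg _ _)
    (measurableSet_omegaSet _ _) fun p hp => h p (omegaSet_subset_closedBox _ _ hp)

theorem intOn_nonneg {f : Pt → ℝ} (h : ∀ p, 0 ≤ f p) (L1 L2 : ℝ) : 0 ≤ intOn L1 L2 f :=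
  integral_nonneg h

theorem intOn_add {f g : Pt → ℝ} (hf : Continuous f) (hg : Continuous g) (L1 L2 : ℝ) :
    intOn L1 L2 (fun p => f p + g p) = intOn L1 L2 f + intOn L1 L2 g :=
  integral_add (integrableOn_omegaSet hf _ _) (integrableOn_omegaSet hg _ _)

theorem intOn_sub {f g : Pt → ℝ} (hf : Continuous f) (hg : Continuous g) (L1 L2 : ℝ) :
    intOn L1 L2 (fun p => f p - g p) = intOn L1 L2 f - intOn L1 L2 g :=
  integral_sub (integrableOn_omegaSet hf _ _) (integrableOn_omegaSet hg _ _)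

theorem intOn_const_mul (f : Pt → ℝ) (L1 L2 c : ℝ) :
    intOn L1 L2 (fun p => c * f p) = c * intOn L1 L2 f :=
  integral_const_mul _ _

theorem integral_prod_fst_average {α β : Type*} [MeasurableSpace α] [MeasurableSpace β]
    {μ : Measure α} {ν : Measure β} [IsFiniteMeasure μ] [IsFiniteMeasure ν] {F : α × β → ℝ}
    (hF : Integrable F (μ.prod ν)) :
    ∫ q, (∫ t, F (t, q.2) ∂μ) ∂(μ.prod ν) = μ.real univ * ∫ q, F q ∂(μ.prod ν) := by
  rw [integral_fun_snd (fun b => ∫ t, F (t, b) ∂μ), integral_prod_symm _ hF, smul_eq_mul]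

theorem integral_prod_snd_average {α β : Type*} [MeasurableSpace α] [MeasurableSpace β]
    {μ : Measure α} {ν : Measure β} [IsFiniteMeasure μ] [IsFiniteMeasure ν] {F : α × β → ℝ}
    (hF : Integrable F (μ.prod ν)) :
    ∫ q, (∫ t, F (q.1, t) ∂ν) ∂(μ.prod ν) = ν.real univ * ∫ q, F q ∂(μ.prod ν) := by
  rw [integral_fun_fst (fun a => ∫ t, F (a, t) ∂ν), integral_prod _ hF, smul_eq_mul]

theorem integrableOn_rect {f : ℝ × ℝ → ℝ} (hf : Continuous f) (a b c d : ℝ) :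
    Integrable f ((volume.restrict (Ioo a b)).prod (volume.restrict (Ioo c d))) := by
  rw [Measure.prod_restrict]
  exact (hf.continuousOn.integrableOn_compact
    ((isCompact_Icc (a := a) (b := b)).prod (isCompact_Icc (a := c) (b := d)))).mono_set
    (prod_mono Ioo_subset_Icc_self Ioo_subset_Icc_self)

theorem lineInt_eq_setIntegral {L1 L2 : ℝ} (hL1 : 0 < L1) (hL2 : 0 < L2) (i : Fin 3)
    (f : Pt → ℝ) (p : Pt) :
    lineInt L1 L2 i f p = ∫ t in Ioo (lower i) (upper L1 L2 i), f (slide i p t) := by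
  rw [lineInt, intervalIntegral.integral_of_le (lower_lt_upper hL1 hL2 i).le,
    integral_Ioc_eq_integral_Ioo]

theorem intOn_lineInt {L1 L2 : ℝ} (hL1 : 0 < L1) (hL2 : 0 < L2) {f : Pt → ℝ}
    (hf : Continuous f) (i : Fin 3) :
    intOn L1 L2 (lineInt L1 L2 i f) = sideLen L1 L2 i * intOn L1 L2 f := by
  have hi := integrableOn_omegaSet hf L1 L2
  have hi' := integrableOn_omegaSet (continuous_lineInt hf L1 L2 i) L1 L2
  have hlen : ∀ i, (volume.restrict (Ioo (lower i) (upper L1 L2 i))).real univ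
      = sideLen L1 L2 i := by
    intro i
    simp [sideLen, (lower_lt_upper hL1 hL2 i).le]
  have hfun := funext (lineInt_eq_setIntegral hL1 hL2 i f)
  unfold intOn
  rw [IntegrableOn, restrict_omegaSet] at hi hi'
  rw [restrict_omegaSet]
  rw [← hlen i]
  fin_cases i
  · rw [hfun]
    exact integral_prod_fst_average hi
  · rw [integral_prod _ hi', integral_prod _ hi, ← integral_const_mul]
    rw [hfun]
    congr 1
    funext x
    exact integral_prod_fst_average (F := fun q => f (x, q)) (integrableOn_rect (by fun_prop) _ _ _ _)
  · rw [integral_prod _ hi', integral_prod _ hi, ← integral_const_mul]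
    rw [hfun]
    congr 1
    funext x
    exact integral_prod_snd_average (F := fun q => f (x, q)) (integrableOn_rect (by fun_prop) _ _ _ _)

/-- A function of `x` and a function of `(y, z)` are independent on `Ω`. -/
theorem intOn_lineInt_mul {L1 L2 : ℝ} (hL1 : 0 < L1) (hL2 : 0 < L2) {k m : Pt → ℝ}
    (hk : Continuous k) (hm : Continuous m) :
    intOn L1 L2 (fun p => lineInt L1 L2 2 (lineInt L1 L2 1 k) p * lineInt L1 L2 0 m p)
      = intOn L1 L2 k * intOn L1 L2 m := by
  have hki := integrableOn_omegaSet hk L1 L2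
  have hmi := integrableOn_omegaSet hm L1 L2
  rw [IntegrableOn, restrict_omegaSet] at hki hmi
  unfold intOn
  rw [restrict_omegaSet, integral_prod _ hki, integral_prod_symm _ hmi, ← integral_prod_mul]
  congr 1
  funext p
  beta_reduce
  rw [lineInt_eq_setIntegral hL1 hL2 0, lineInt_eq_setIntegral hL1 hL2 2]
  simp only [lineInt_eq_setIntegral hL1 hL2 1]
  rw [integral_prod_symm _ (integrableOn_rect (by fun_prop) _ _ _ _)]
  rfl

theorem L2sq_nonneg (L1 L2 : ℝ) (f : Pt → ℝ) : 0 ≤ L2sq L1 L2 f :=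
  intOn_nonneg (fun _ => sq_nonneg _) _ _

theorem abs_intOn_mul_le {f g : Pt → ℝ} (hf : Continuous f) (hg : Continuous g) (L1 L2 : ℝ) :
    |intOn L1 L2 (fun p => f p * g p)| ≤ L2n L1 L2 f * L2n L1 L2 g := by
  have h := sq_integral_mul_le (integrableOn_omegaSet (hf.pow 2) L1 L2)
    (integrableOn_omegaSet (hg.pow 2) L1 L2) (integrableOn_omegaSet (hf.mul hg) L1 L2)
  rw [L2n, L2n, ← Real.sqrt_mul (L2sq_nonneg _ _ _)]
  exact Real.abs_le_sqrt h

theorem L2n_mul_self (L1 L2 : ℝ) (f : Pt → ℝ) : L2n L1 L2 f * L2n L1 L2 f = L2sq L1 L2 f :=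
  Real.mul_self_sqrt (L2sq_nonneg _ _ _)

theorem L2n_le_of_sq_le {L1 L2 c : ℝ} (hc : 0 ≤ c) {f : Pt → ℝ} (h : L2sq L1 L2 f ≤ c ^ 2) :
    L2n L1 L2 f ≤ c :=
  Real.sqrt_le_iff.2 ⟨hc, h⟩

theorem L2sq_const_mul (L1 L2 c : ℝ) (f : Pt → ℝ) :
    L2sq L1 L2 (fun p => c * f p) = c ^ 2 * L2sq L1 L2 f := by
  simp only [L2sq, mul_pow, intOn_const_mul]

theorem L2sq_lineInt_le {L1 L2 : ℝ} (hL1 : 0 < L1) (hL2 : 0 < L2) {f : Pt → ℝ}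
    (hf : Continuous f) (i : Fin 3) :
    L2sq L1 L2 (lineInt L1 L2 i f) ≤ sideLen L1 L2 i ^ 2 * L2sq L1 L2 f := by
  calc L2sq L1 L2 (lineInt L1 L2 i f)
      ≤ intOn L1 L2 (fun p => sideLen L1 L2 i * lineInt L1 L2 i (fun q => f q ^ 2) p) :=
        intOn_mono ((continuous_lineInt hf _ _ _).pow 2)
          ((continuous_lineInt (hf.pow 2) _ _ _).const_mul _)
          fun p _ => sq_lineInt_le hL1 hL2 hf i p
    _ = _ := by
        rw [intOn_const_mul, intOn_lineInt hL1 hL2 (f := fun q => f q ^ 2) (hf.pow 2), L2sq]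
        ring

theorem L2sq_sideLen_mul_sub_lineInt_le {L1 L2 : ℝ} (hL1 : 0 < L1) (hL2 : 0 < L2) {f : Pt → ℝ}
    (hf : ContDiff ℝ (⊤ : ℕ∞) f) (i : Fin 3) :
    L2sq L1 L2 (fun p => sideLen L1 L2 i * f p - lineInt L1 L2 i f p)
      ≤ sideLen L1 L2 i ^ 4 * L2sq L1 L2 (pd i f) := by
  have hc := hf.continuous
  have hc' := (contDiff_pd hf i).continuous
  have hl := continuous_lineInt hc L1 L2 i
  calc L2sq L1 L2 (fun p => sideLen L1 L2 i * f p - lineInt L1 L2 i f p)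
      ≤ intOn L1 L2 (fun p => sideLen L1 L2 i ^ 3 * lineInt L1 L2 i (fun q => pd i f q ^ 2) p) :=
        intOn_mono (by fun_prop) ((continuous_lineInt (hc'.pow 2) _ _ _).const_mul _)
          fun p hp => sq_sideLen_mul_sub_lineInt_le hL1 hL2 hf i hp
    _ = _ := by
        rw [intOn_const_mul, intOn_lineInt hL1 hL2 (f := fun q => pd i f q ^ 2) (hc'.pow 2), L2sq]
        ring

/-- One-dimensional Poincaré inequality for a derivative of a periodic function. -/
theorem L2sq_pd_le {L1 L2 : ℝ} (hL1 : 0 < L1) (hL2 : 0 < L2) {f : Pt → ℝ}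
    (hf : ContDiff ℝ (⊤ : ℕ∞) f) (hp : SidePeriodic L1 L2 f) (i : Fin 3) :
    L2sq L1 L2 (pd i f) ≤ sideLen L1 L2 i ^ 2 * L2sq L1 L2 (pd i (pd i f)) := by
  have hl := sideLen_pos hL1 hL2 i
  have h := L2sq_sideLen_mul_sub_lineInt_le hL1 hL2 (contDiff_pd hf i) i
  simp only [lineInt_pd hf hp, sub_zero] at h
  rw [L2sq_const_mul] at h
  refine le_of_mul_le_mul_left ?_ (pow_pos hl 2)
  linarith

theorem intOn_pd {L1 L2 : ℝ} (hL1 : 0 < L1) (hL2 : 0 < L2) {f : Pt → ℝ}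
    (hf : ContDiff ℝ (⊤ : ℕ∞) f) (hp : SidePeriodic L1 L2 f) (i : Fin 3) :
    intOn L1 L2 (pd i f) = 0 := by
  have h := intOn_lineInt hL1 hL2 (contDiff_pd hf i).continuous i
  rw [funext (lineInt_pd hf hp i)] at h
  have h0 : intOn L1 L2 (fun _ => 0) = 0 := integral_zero _ _
  exact (mul_eq_zero.1 (h.symm.trans h0)).resolve_left (sideLen_pos hL1 hL2 i).ne'

theorem intOn_pd_pd_mul {L1 L2 : ℝ} (hL1 : 0 < L1) (hL2 : 0 < L2) {f : Pt → ℝ}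
    (hf : ContDiff ℝ (⊤ : ℕ∞) f) (hp : SidePeriodic L1 L2 f) (i j : Fin 3) :
    intOn L1 L2 (fun p => pd i (pd i f) p * pd j (pd j f) p) = L2sq L1 L2 (pd i (pd j f)) := by
  have hi := contDiff_pd hf i
  have hj := contDiff_pd hf j
  have hjj := contDiff_pd hj j
  have hji := contDiff_pd hi j
  have h1 := intOn_pd hL1 hL2 (hi.mul hjj) ((hp.pd hf i).mul ((hp.pd hf j).pd hj j)) i
  have h2 := intOn_pd hL1 hL2 (hi.mul hji) ((hp.pd hf i).mul ((hp.pd hf i).pd hi j)) j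
  have h3 := intOn_sub (contDiff_pd (hi.mul hjj) i).continuous
    (contDiff_pd (hi.mul hji) j).continuous L1 L2
  rw [h1, h2, sub_zero] at h3
  have h4 : ∀ p, pd i (fun q => pd i f q * pd j (pd j f) q) p
      - pd j (fun q => pd i f q * pd j (pd i f) q) p
      = pd i (pd i f) p * pd j (pd j f) p - pd i (pd j f) p ^ 2 := by
    intro p
    rw [pd_mul hi hjj, pd_mul hi hji, pd_comm hj i j, pd_comm hf i j]
    ring
  have h5 := intOn_sub ((contDiff_pd hi i).continuous.mul hjj.continuous)
    ((contDiff_pd hj i).continuous.pow 2) L1 L2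
  have h6 : intOn L1 L2 (fun p => pd i (pd i f) p * pd j (pd j f) p - pd i (pd j f) p ^ 2) = 0 := by
    rw [← h3]
    exact congrArg _ (funext fun p => (h4 p).symm)
  exact sub_eq_zero.1 (h5.symm.trans h6)

theorem intOn_sum {ι : Type*} (s : Finset ι) {f : ι → Pt → ℝ} (hf : ∀ i ∈ s, Continuous (f i))
    (L1 L2 : ℝ) : intOn L1 L2 (fun p => ∑ i ∈ s, f i p) = ∑ i ∈ s, intOn L1 L2 (f i) :=
  integral_finsetSum _ fun i hi => integrableOn_omegaSet (hf i hi) _ _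

theorem lap_eq_sum (f : Pt → ℝ) (p : Pt) : lap f p = ∑ i, pd i (pd i f) p := by
  rw [Fin.sum_univ_three]
  rfl

theorem gradSq_eq_sum (f : Pt → ℝ) (p : Pt) : gradSq f p = ∑ i, pd i f p ^ 2 := by
  rw [Fin.sum_univ_three]
  rfl

theorem intOn_gradSq {f : Pt → ℝ} (hf : ContDiff ℝ (⊤ : ℕ∞) f) (L1 L2 : ℝ) :
    intOn L1 L2 (gradSq f) = ∑ i, L2sq L1 L2 (pd i f) := by
  rw [funext (gradSq_eq_sum f)]
  exact intOn_sum _ (fun i _ => (contDiff_pd hf i).continuous.pow 2) _ _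

theorem L2sq_lap {L1 L2 : ℝ} (hL1 : 0 < L1) (hL2 : 0 < L2) {f : Pt → ℝ}
    (hf : ContDiff ℝ (⊤ : ℕ∞) f) (hp : SidePeriodic L1 L2 f) :
    L2sq L1 L2 (lap f) = ∑ i, ∑ j, L2sq L1 L2 (pd i (pd j f)) := by
  have hc : ∀ i j, Continuous fun p => pd i (pd i f) p * pd j (pd j f) p := fun i j =>
    (contDiff_pd (contDiff_pd hf i) i).continuous.mul (contDiff_pd (contDiff_pd hf j) j).continuous
  simp only [L2sq, lap_eq_sum, sq (∑ i, _), Finset.sum_mul_sum]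
  rw [intOn_sum _ fun i _ => continuous_finsetSum _ fun j _ => hc i j]
  refine Finset.sum_congr rfl fun i _ => ?_
  rw [intOn_sum _ fun j _ => hc i j]
  exact Finset.sum_congr rfl fun j _ => intOn_pd_pd_mul hL1 hL2 hf hp i j

theorem L2n_pd_pd_le_lap {L1 L2 : ℝ} (hL1 : 0 < L1) (hL2 : 0 < L2) {f : Pt → ℝ}
    (hf : ContDiff ℝ (⊤ : ℕ∞) f) (hp : SidePeriodic L1 L2 f) (i j : Fin 3) :
    L2n L1 L2 (pd i (pd j f)) ≤ L2n L1 L2 (lap f) := by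
  refine Real.sqrt_le_sqrt ?_
  rw [L2sq_lap hL1 hL2 hf hp]
  exact (Finset.single_le_sum (f := fun j => L2sq L1 L2 (pd i (pd j f)))
      (fun _ _ => L2sq_nonneg _ _ _) (Finset.mem_univ j)).trans
    (Finset.single_le_sum (f := fun i => ∑ j, L2sq L1 L2 (pd i (pd j f)))
      (fun _ _ => Finset.sum_nonneg fun _ _ => L2sq_nonneg _ _ _) (Finset.mem_univ i))

theorem L2n_pd_le_lap {L1 L2 : ℝ} (hL1 : 0 < L1) (hL2 : 0 < L2) {f : Pt → ℝ}
    (hf : ContDiff ℝ (⊤ : ℕ∞) f) (hp : SidePeriodic L1 L2 f) (i : Fin 3) :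
    L2n L1 L2 (pd i f) ≤ sideLen L1 L2 i * L2n L1 L2 (lap f) := by
  refine le_trans ?_ (mul_le_mul_of_nonneg_left (L2n_pd_pd_le_lap hL1 hL2 hf hp i i)
    (sideLen_pos hL1 hL2 i).le)
  refine L2n_le_of_sq_le (mul_nonneg (sideLen_pos hL1 hL2 i).le (Real.sqrt_nonneg _)) ?_
  rw [mul_pow, Real.sq_sqrt (L2sq_nonneg _ _ _)]
  exact L2sq_pd_le hL1 hL2 hf hp i

theorem L2n_pd_le_grad {f : Pt → ℝ} (hf : ContDiff ℝ (⊤ : ℕ∞) f) (L1 L2 : ℝ) (i : Fin 3) :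
    L2n L1 L2 (pd i f) ≤ L2grad L1 L2 f := by
  refine Real.sqrt_le_sqrt ?_
  rw [intOn_gradSq hf]
  exact Finset.single_le_sum (f := fun i => L2sq L1 L2 (pd i f))
    (fun _ _ => L2sq_nonneg _ _ _) (Finset.mem_univ i)

theorem lineInt_lineInt_lineInt {L1 L2 : ℝ} (hL1 : 0 < L1) (hL2 : 0 < L2) {f : Pt → ℝ}
    (hf : Continuous f) (p : Pt) :
    lineInt L1 L2 0 (lineInt L1 L2 1 (lineInt L1 L2 2 f)) p = intOn L1 L2 f := by
  have hi := integrableOn_omegaSet hf L1 L2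
  unfold intOn
  rw [IntegrableOn, restrict_omegaSet] at hi
  rw [restrict_omegaSet, integral_prod _ hi, lineInt_eq_setIntegral hL1 hL2 0]
  congr 1
  funext x
  rw [lineInt_eq_setIntegral hL1 hL2 1, integral_prod _ (integrableOn_rect (by fun_prop) _ _ _ _)]
  simp only [lineInt_eq_setIntegral hL1 hL2 2]
  rfl

theorem lineInt_sub {f g : Pt → ℝ} (hf : Continuous f) (hg : Continuous g) (L1 L2 : ℝ)
    (i : Fin 3) (p : Pt) :
    lineInt L1 L2 i (fun q => f q - g q) p = lineInt L1 L2 i f p - lineInt L1 L2 i g p :=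
  intervalIntegral.integral_sub ((continuous_comp_slide hf i p).intervalIntegrable _ _)
    ((continuous_comp_slide hg i p).intervalIntegrable _ _)

/-- Poincaré inequality for functions of zero mean. -/
theorem L2sq_le_of_intOn_eq_zero {L1 L2 : ℝ} (hL1 : 0 < L1) (hL2 : 0 < L2) {f : Pt → ℝ}
    (hf : ContDiff ℝ (⊤ : ℕ∞) f) (h0 : intOn L1 L2 f = 0) :
    L2sq L1 L2 f ≤ 3 * ∑ i, sideLen L1 L2 i ^ 2 * L2sq L1 L2 (pd i f) := by
  have hc := hf.continuous
  have hI : ∀ i, Continuous (lineInt L1 L2 i f) := fun i => continuous_lineInt hc L1 L2 i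
  set l := sideLen L1 L2 with hl
  let d : Fin 3 → Pt → ℝ := fun i p => l i * f p - lineInt L1 L2 i f p
  have hd : ∀ i, Continuous (d i) := fun i => (hc.const_mul _).sub (hI i)
  have hdle : ∀ i, L2sq L1 L2 (d i) ≤ l i ^ 4 * L2sq L1 L2 (pd i f) := fun i =>
    L2sq_sideLen_mul_sub_lineInt_le hL1 hL2 hf i
  have hd1 := continuous_lineInt (hd 1) L1 L2 0
  have hd2 := continuous_lineInt (hd 2) L1 L2 1
  have hd3 := continuous_lineInt hd2 L1 L2 0
  have hlin1 : ∀ p, lineInt L1 L2 0 (d 1) p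
      = l 1 * lineInt L1 L2 0 f p - lineInt L1 L2 0 (lineInt L1 L2 1 f) p := fun p => by
    rw [lineInt_sub (hc.const_mul _) (hI 1), lineInt_const_mul]
  have hlin2 : ∀ p, lineInt L1 L2 1 (d 2) p
      = l 2 * lineInt L1 L2 1 f p - lineInt L1 L2 1 (lineInt L1 L2 2 f) p := fun p => by
    rw [lineInt_sub (hc.const_mul _) (hI 2), lineInt_const_mul]
  have hlin3 : ∀ p, lineInt L1 L2 0 (lineInt L1 L2 1 (d 2)) p
      = l 2 * lineInt L1 L2 0 (lineInt L1 L2 1 f) p := fun p => by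
    rw [funext hlin2, lineInt_sub ((hI 1).const_mul _) (continuous_lineInt (hI 2) _ _ _),
      lineInt_const_mul, lineInt_lineInt_lineInt hL1 hL2 hc, h0, sub_zero]
  have hpt : ∀ p, (l 0 * l 1 * l 2 * f p) ^ 2 ≤ 3 * (l 1 * l 2 * d 0 p) ^ 2
      + 3 * (l 2 * lineInt L1 L2 0 (d 1) p) ^ 2
      + 3 * (lineInt L1 L2 0 (lineInt L1 L2 1 (d 2)) p) ^ 2 := by
    intro p
    have he : l 0 * l 1 * l 2 * f p = l 1 * l 2 * d 0 p + l 2 * lineInt L1 L2 0 (d 1) p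
        + lineInt L1 L2 0 (lineInt L1 L2 1 (d 2)) p := by
      rw [hlin1, hlin3]
      simp only [d]
      ring
    rw [he]
    nlinarith [sq_nonneg (l 1 * l 2 * d 0 p - l 2 * lineInt L1 L2 0 (d 1) p),
      sq_nonneg (l 1 * l 2 * d 0 p - lineInt L1 L2 0 (lineInt L1 L2 1 (d 2)) p),
      sq_nonneg (l 2 * lineInt L1 L2 0 (d 1) p - lineInt L1 L2 0 (lineInt L1 L2 1 (d 2)) p)]
  have hd0 := hd 0
  have hint := intOn_mono (L1 := L1) (L2 := L2) (by fun_prop) (by fun_prop) fun p _ => hpt p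
  rw [intOn_add (by fun_prop) (by fun_prop), intOn_add (by fun_prop) (by fun_prop),
    intOn_const_mul, intOn_const_mul, intOn_const_mul] at hint
  change L2sq L1 L2 (fun p => l 0 * l 1 * l 2 * f p) ≤
    3 * L2sq L1 L2 (fun p => l 1 * l 2 * d 0 p)
      + 3 * L2sq L1 L2 (fun p => l 2 * lineInt L1 L2 0 (d 1) p)
      + 3 * L2sq L1 L2 (lineInt L1 L2 0 (lineInt L1 L2 1 (d 2))) at hint
  rw [L2sq_const_mul, L2sq_const_mul, L2sq_const_mul] at hint
  have b0 := hdle 0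
  have b1 : L2sq L1 L2 (lineInt L1 L2 0 (d 1)) ≤ l 0 ^ 2 * (l 1 ^ 4 * L2sq L1 L2 (pd 1 f)) :=
    (L2sq_lineInt_le hL1 hL2 (hd 1) 0).trans
      (mul_le_mul_of_nonneg_left (hdle 1) (sq_nonneg _))
  have b2 : L2sq L1 L2 (lineInt L1 L2 0 (lineInt L1 L2 1 (d 2)))
      ≤ l 0 ^ 2 * (l 1 ^ 2 * (l 2 ^ 4 * L2sq L1 L2 (pd 2 f))) :=
    (L2sq_lineInt_le hL1 hL2 hd2 0).trans (mul_le_mul_of_nonneg_left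
      ((L2sq_lineInt_le hL1 hL2 (hd 2) 1).trans
        (mul_le_mul_of_nonneg_left (hdle 2) (sq_nonneg _))) (sq_nonneg _))
  have hpos : 0 < (l 0 * l 1 * l 2) ^ 2 := by
    have := fun i => sideLen_pos hL1 hL2 i
    have h0 := this 0
    have h1 := this 1
    have h2 := this 2
    positivity
  refine le_of_mul_le_mul_left ?_ hpos
  rw [Fin.sum_univ_three]
  have b0' := mul_le_mul_of_nonneg_left b0 (sq_nonneg (l 1 * l 2))
  have b1' := mul_le_mul_of_nonneg_left b1 (sq_nonneg (l 2))
  linarith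

theorem intOn_supDensity_le {L1 L2 K G A : ℝ} (hL1 : 0 < L1) (hL2 : 0 < L2) {h : Pt → ℝ}
    (hh : ContDiff ℝ (⊤ : ℕ∞) h) (i : Fin 3) (hK : 0 ≤ K) (hG : 0 ≤ G)
    (h1 : L2n L1 L2 h ≤ K * G) (h2 : L2n L1 L2 h ≤ K * A) (h3 : L2n L1 L2 (pd i h) ≤ K * A) :
    intOn L1 L2 (supDensity L1 L2 i h) ≤ (K ^ 2 / sideLen L1 L2 i + 2 * K ^ 2) * (G * A) := by
  have hl := sideLen_pos hL1 hL2 i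
  have hc := hh.continuous
  have hc' := (contDiff_pd hh i).continuous
  have hKG : 0 ≤ K * G := mul_nonneg hK hG
  have e : supDensity L1 L2 i h = fun p => (sideLen L1 L2 i)⁻¹ * h p ^ 2
      + 2 * (|h p| * |pd i h p|) := by
    funext p
    rw [supDensity]
    ring
  have a1 : intOn L1 L2 (fun p => h p ^ 2) ≤ K ^ 2 * (G * A) := by
    change L2sq L1 L2 h ≤ _
    rw [← L2n_mul_self]
    calc L2n L1 L2 h * L2n L1 L2 h ≤ (K * G) * (K * A) :=
          mul_le_mul h1 h2 (Real.sqrt_nonneg _) hKG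
      _ = _ := by ring
  have a2 : intOn L1 L2 (fun p => |h p| * |pd i h p|) ≤ K ^ 2 * (G * A) := by
    refine (le_abs_self _).trans ((abs_intOn_mul_le hc.abs hc'.abs L1 L2).trans ?_)
    simp only [L2n, L2sq, sq_abs]
    calc L2n L1 L2 h * L2n L1 L2 (pd i h) ≤ (K * G) * (K * A) :=
          mul_le_mul h1 h3 (Real.sqrt_nonneg _) hKG
      _ = _ := by ring
  rw [e, intOn_add (by fun_prop) (by fun_prop), intOn_const_mul, intOn_const_mul]
  calc _ ≤ (sideLen L1 L2 i)⁻¹ * (K ^ 2 * (G * A)) + 2 * (K ^ 2 * (G * A)) := by gcongr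
    _ = _ := by ring

/-- Anisotropic product estimate: `w` is controlled by vertical integrals of `h₁` and `h₂`, the
latter by their `y`-derivatives, and `g` by its `x`-derivative. -/
theorem L2sq_mul_le {L1 L2 : ℝ} (hL1 : 0 < L1) (hL2 : 0 < L2) {w h₁ h₂ g : Pt → ℝ}
    (hw : Continuous w) (hh₁ : ContDiff ℝ (⊤ : ℕ∞) h₁) (hh₂ : ContDiff ℝ (⊤ : ℕ∞) h₂)
    (hg : ContDiff ℝ (⊤ : ℕ∞) g)
    (hwh : ∀ p ∈ closedBox L1 L2,
      w p ^ 2 ≤ 4 * lineInt L1 L2 2 (fun q => h₁ q ^ 2 + h₂ q ^ 2) p) :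
    L2sq L1 L2 (fun p => w p * g p) ≤ 4 *
      ((intOn L1 L2 (supDensity L1 L2 1 h₁) + intOn L1 L2 (supDensity L1 L2 1 h₂)) *
        intOn L1 L2 (supDensity L1 L2 0 g)) := by
  have c1 := hh₁.continuous
  have c2 := hh₂.continuous
  have cg := hg.continuous
  have s1 := continuous_supDensity hh₁ L1 L2 1
  have s2 := continuous_supDensity hh₂ L1 L2 1
  have s0 := continuous_supDensity hg L1 L2 0
  have cs : Continuous (fun p => supDensity L1 L2 1 h₁ p + supDensity L1 L2 1 h₂ p) := s1.add s2
  have cl1 := continuous_lineInt cs L1 L2 1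
  have cl2 := continuous_lineInt cl1 L1 L2 2
  have cl0 := continuous_lineInt s0 L1 L2 0
  rw [← intOn_add s1 s2, ← intOn_lineInt_mul hL1 hL2 cs s0, ← intOn_const_mul]
  refine intOn_mono ((hw.mul cg).pow 2) ((cl2.mul cl0).const_mul 4) fun p hp => ?_
  have b0 := sq_le_lineInt_supDensity hL1 hL2 hg 0 hp
  have b1 : lineInt L1 L2 2 (fun q => h₁ q ^ 2 + h₂ q ^ 2) p ≤ lineInt L1 L2 2
      (lineInt L1 L2 1 (fun q => supDensity L1 L2 1 h₁ q + supDensity L1 L2 1 h₂ q)) p := by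
    refine lineInt_mono hL1 hL2 (by fun_prop) cl1 (fun q hq => ?_) 2 hp
    rw [lineInt_add s1 s2]
    exact add_le_add (sq_le_lineInt_supDensity hL1 hL2 hh₁ 1 hq)
      (sq_le_lineInt_supDensity hL1 hL2 hh₂ 1 hq)
  have b2 : 0 ≤ lineInt L1 L2 2 (fun q => h₁ q ^ 2 + h₂ q ^ 2) p :=
    lineInt_nonneg hL1 hL2 (fun _ => by positivity) 2 p
  rw [mul_pow]
  calc w p ^ 2 * g p ^ 2
      ≤ (4 * lineInt L1 L2 2 (fun q => h₁ q ^ 2 + h₂ q ^ 2) p) *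
        lineInt L1 L2 0 (supDensity L1 L2 0 g) p :=
        mul_le_mul (hwh p hp) b0 (sq_nonneg _) (by positivity)
    _ ≤ (4 * lineInt L1 L2 2 (lineInt L1 L2 1
          (fun q => supDensity L1 L2 1 h₁ q + supDensity L1 L2 1 h₂ q)) p) *
        lineInt L1 L2 0 (supDensity L1 L2 0 g) p :=
        mul_le_mul_of_nonneg_right (by linarith) ((sq_nonneg _).trans b0)
    _ = _ := by ring

theorem abs_intOn_mul_mul_le {L1 L2 K G A G' A' : ℝ} (hL1 : 0 < L1) (hL2 : 0 < L2)
    {w h₁ h₂ g ψ : Pt → ℝ}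
    (hw : Continuous w) (hh₁ : ContDiff ℝ (⊤ : ℕ∞) h₁) (hh₂ : ContDiff ℝ (⊤ : ℕ∞) h₂)
    (hg : ContDiff ℝ (⊤ : ℕ∞) g) (hψ : Continuous ψ)
    (hwh : ∀ p ∈ closedBox L1 L2,
      w p ^ 2 ≤ 4 * lineInt L1 L2 2 (fun q => h₁ q ^ 2 + h₂ q ^ 2) p)
    (hK : 0 ≤ K) (hG : 0 ≤ G) (hA : 0 ≤ A) (hG' : 0 ≤ G') (hA' : 0 ≤ A')
    (hh₁G : L2n L1 L2 h₁ ≤ K * G) (hh₁A : L2n L1 L2 h₁ ≤ K * A)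
    (hh₁y : L2n L1 L2 (pd 1 h₁) ≤ K * A)
    (hh₂G : L2n L1 L2 h₂ ≤ K * G) (hh₂A : L2n L1 L2 h₂ ≤ K * A)
    (hh₂y : L2n L1 L2 (pd 1 h₂) ≤ K * A)
    (hgG : L2n L1 L2 g ≤ K * G') (hgA : L2n L1 L2 g ≤ K * A')
    (hgx : L2n L1 L2 (pd 0 g) ≤ K * A') :
    |intOn L1 L2 (fun p => w p * g p * ψ p)| ≤
      3 * (K ^ 2 / L1 + K ^ 2 / L2 + 2 * K ^ 2) *
        (Real.sqrt G * Real.sqrt A * Real.sqrt G' * Real.sqrt A') * L2n L1 L2 ψ := by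
  set M := K ^ 2 / L1 + K ^ 2 / L2 + 2 * K ^ 2 with hM
  have hM0 : 0 ≤ M := by positivity
  have l0 : sideLen L1 L2 0 = L1 := sub_zero _
  have l1 : sideLen L1 L2 1 = L2 := sub_zero _
  have q1 : 0 ≤ K ^ 2 / L1 := by positivity
  have q2 : 0 ≤ K ^ 2 / L2 := by positivity
  have hGA := mul_nonneg hG hA
  have hGA' := mul_nonneg hG' hA'
  have i1 : intOn L1 L2 (supDensity L1 L2 1 h₁) ≤ M * (G * A) :=
    (intOn_supDensity_le hL1 hL2 hh₁ 1 hK hG hh₁G hh₁A hh₁y).trans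
      (mul_le_mul_of_nonneg_right (by rw [l1]; linarith) hGA)
  have i2 : intOn L1 L2 (supDensity L1 L2 1 h₂) ≤ M * (G * A) :=
    (intOn_supDensity_le hL1 hL2 hh₂ 1 hK hG hh₂G hh₂A hh₂y).trans
      (mul_le_mul_of_nonneg_right (by rw [l1]; linarith) hGA)
  have i3 : intOn L1 L2 (supDensity L1 L2 0 g) ≤ M * (G' * A') :=
    (intOn_supDensity_le hL1 hL2 hg 0 hK hG' hgG hgA hgx).trans
      (mul_le_mul_of_nonneg_right (by rw [l0]; linarith) hGA')
  refine (abs_intOn_mul_le (hw.mul hg.continuous) hψ L1 L2).trans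
    (mul_le_mul_of_nonneg_right ?_ (Real.sqrt_nonneg _))
  refine L2n_le_of_sq_le (by positivity) ((L2sq_mul_le hL1 hL2 hw hh₁ hh₂ hg hwh).trans ?_)
  calc _ ≤ 4 * ((M * (G * A) + M * (G * A)) * (M * (G' * A'))) := by
        refine mul_le_mul_of_nonneg_left (mul_le_mul (add_le_add i1 i2) i3
          (intOn_nonneg (supDensity_nonneg hL1 hL2 0 g) _ _) (by positivity)) (by norm_num)
    _ = 8 * M ^ 2 * (G * A * G' * A') := by ring
    _ ≤ 9 * M ^ 2 * (G * A * G' * A') := by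
        have : 0 ≤ M ^ 2 * (G * A * G' * A') := by positivity
        linarith
    _ = _ := by
        simp only [mul_pow, Real.sq_sqrt hG, Real.sq_sqrt hA, Real.sq_sqrt hG', Real.sq_sqrt hA']
        norm_num

theorem sq_le_lineInt_sq_add_sq_pd {L1 L2 : ℝ} (hL1 : 0 < L1) (hL2 : 0 < L2) {u : Pt → ℝ}
    (hu : ContDiff ℝ (⊤ : ℕ∞) u) {p : Pt} (hp : p ∈ closedBox L1 L2) :
    u p ^ 2 ≤ 4 * lineInt L1 L2 2 (fun q => u q ^ 2 + pd 2 u q ^ 2) p := by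
  have hc := hu.continuous
  have hc' := (contDiff_pd hu 2).continuous
  have l2 : sideLen L1 L2 2 = 2 := by norm_num [sideLen, upper, lower]
  rw [← lineInt_const_mul]
  refine (sq_le_lineInt_supDensity hL1 hL2 hu 2 hp).trans
    (lineInt_mono hL1 hL2 (continuous_supDensity hu _ _ _) (by fun_prop) (fun q _ => ?_) 2 hp)
  rw [supDensity, l2]
  nlinarith [sq_nonneg (|u q| - |pd 2 u q|), sq_abs (u q), sq_abs (pd 2 u q), sq_nonneg (u q),
    sq_nonneg (pd 2 u q)]

theorem sq_le_lineInt_of_pd_eq {L1 L2 : ℝ} (hL1 : 0 < L1) (hL2 : 0 < L2) {u h₁ h₂ : Pt → ℝ}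
    (hu : ContDiff ℝ (⊤ : ℕ∞) u) (h₁c : Continuous h₁) (h₂c : Continuous h₂)
    (hdiv : ∀ p, h₁ p + h₂ p + pd 2 u p = 0) (hu0 : ∀ x y, u (x, y, 0) = 0) {p : Pt}
    (hp : p ∈ closedBox L1 L2) :
    u p ^ 2 ≤ 4 * lineInt L1 L2 2 (fun q => h₁ q ^ 2 + h₂ q ^ 2) p := by
  have hc' := (contDiff_pd hu 2).continuous
  have l2 : sideLen L1 L2 2 = 2 := by norm_num [sideLen, upper, lower]
  have h0 : (0 : ℝ) ∈ Icc (lower 2) (upper L1 L2 2) := by norm_num [upper, lower]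
  have h1 := abs_integral_le_integral_abs_of_mem (continuous_comp_slide hc' 2 p) h0 (hp 2)
  rw [intervalIntegral.integral_eq_sub_of_hasDerivAt (fun t _ => hasDerivAt_comp_slide hu 2 p t)
    ((continuous_comp_slide hc' 2 p).intervalIntegrable _ _), slide_coord,
    show u (slide 2 p 0) = 0 from hu0 _ _, sub_zero] at h1
  have h2 := sq_lineInt_le hL1 hL2 hc'.abs 2 p
  simp only [sq_abs] at h2
  rw [l2] at h2
  have h3 : lineInt L1 L2 2 (fun q => pd 2 u q ^ 2) p
      ≤ 2 * lineInt L1 L2 2 (fun q => h₁ q ^ 2 + h₂ q ^ 2) p := by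
    rw [← lineInt_const_mul]
    refine lineInt_mono hL1 hL2 (by fun_prop) (by fun_prop) (fun q _ => ?_) 2 hp
    rw [show pd 2 u q = -(h₁ q + h₂ q) by linarith [hdiv q]]
    nlinarith [sq_nonneg (h₁ q - h₂ q)]
  calc u p ^ 2 = |u p| ^ 2 := (sq_abs _).symm
    _ ≤ lineInt L1 L2 2 (fun q => |pd 2 u q|) p ^ 2 := by
        exact pow_le_pow_left₀ (abs_nonneg _) h1 2
    _ ≤ _ := by linarith

theorem sideLen_le (L1 L2 : ℝ) (hL1 : 0 < L1) (hL2 : 0 < L2) (i : Fin 3) :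
    sideLen L1 L2 i ≤ 3 + L1 + L2 := by
  fin_cases i <;> norm_num [sideLen, upper, lower] <;> linarith

theorem L2n_le_grad {L1 L2 : ℝ} (hL1 : 0 < L1) (hL2 : 0 < L2) {f : Pt → ℝ}
    (hf : ContDiff ℝ (⊤ : ℕ∞) f) (h0 : intOn L1 L2 f = 0) :
    L2n L1 L2 f ≤ 3 * (3 + L1 + L2) * L2grad L1 L2 f := by
  have hg : 0 ≤ intOn L1 L2 (gradSq f) := by
    rw [intOn_gradSq hf]
    exact Finset.sum_nonneg fun _ _ => L2sq_nonneg _ _ _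
  refine L2n_le_of_sq_le (mul_nonneg (by positivity) (Real.sqrt_nonneg _)) ?_
  rw [mul_pow, Real.sq_sqrt hg]
  have h : ∑ i, sideLen L1 L2 i ^ 2 * L2sq L1 L2 (pd i f)
      ≤ (3 + L1 + L2) ^ 2 * intOn L1 L2 (gradSq f) := by
    rw [intOn_gradSq hf, Finset.mul_sum]
    exact Finset.sum_le_sum fun i _ => mul_le_mul_of_nonneg_right
      (pow_le_pow_left₀ (sideLen_pos hL1 hL2 i).le (sideLen_le L1 L2 hL1 hL2 i) 2)
      (L2sq_nonneg _ _ _)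
  have h' : 0 ≤ (3 + L1 + L2) ^ 2 * intOn L1 L2 (gradSq f) := by positivity
  linarith [L2sq_le_of_intOn_eq_zero hL1 hL2 hf h0]

theorem L2grad_le_lap {L1 L2 : ℝ} (hL1 : 0 < L1) (hL2 : 0 < L2) {f : Pt → ℝ}
    (hf : ContDiff ℝ (⊤ : ℕ∞) f) (hp : SidePeriodic L1 L2 f) :
    L2grad L1 L2 f ≤ 3 * (3 + L1 + L2) * L2n L1 L2 (lap f) := by
  refine Real.sqrt_le_iff.2 ⟨mul_nonneg (by positivity) (Real.sqrt_nonneg _), ?_⟩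
  have h : ∀ i, L2sq L1 L2 (pd i f) ≤ ((3 + L1 + L2) * L2n L1 L2 (lap f)) ^ 2 := by
    intro i
    rw [← L2n_mul_self, ← sq]
    exact pow_le_pow_left₀ (Real.sqrt_nonneg _) ((L2n_pd_le_lap hL1 hL2 hf hp i).trans
      (mul_le_mul_of_nonneg_right (sideLen_le L1 L2 hL1 hL2 i) (Real.sqrt_nonneg _))) 2
  rw [intOn_gradSq hf, Fin.sum_univ_three]
  nlinarith [h 0, h 1, h 2, sq_nonneg ((3 + L1 + L2) * L2n L1 L2 (lap f))]

theorem continuous_gradSq {f : Pt → ℝ} (hf : ContDiff ℝ (⊤ : ℕ∞) f) : Continuous (gradSq f) := by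
  rw [funext (gradSq_eq_sum f)]
  exact continuous_finsetSum _ fun i _ => (contDiff_pd hf i).continuous.pow 2

theorem continuous_lap {f : Pt → ℝ} (hf : ContDiff ℝ (⊤ : ℕ∞) f) : Continuous (lap f) := by
  rw [funext (lap_eq_sum f)]
  exact continuous_finsetSum _ fun i _ => (contDiff_pd (contDiff_pd hf i) i).continuous

theorem vGradn_pair {u v : Pt → ℝ} (hu : ContDiff ℝ (⊤ : ℕ∞) u) (hv : ContDiff ℝ (⊤ : ℕ∞) v)
    (L1 L2 : ℝ) : vGradn L1 L2 (fun p => (u p, v p)) =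
      Real.sqrt (intOn L1 L2 (gradSq u) + intOn L1 L2 (gradSq v)) := by
  rw [← intOn_add (continuous_gradSq hu) (continuous_gradSq hv)]
  rfl

theorem vLapn_pair {u v : Pt → ℝ} (hu : ContDiff ℝ (⊤ : ℕ∞) u) (hv : ContDiff ℝ (⊤ : ℕ∞) v)
    (L1 L2 : ℝ) : vLapn L1 L2 (fun p => (u p, v p)) =
      Real.sqrt (L2sq L1 L2 (lap u) + L2sq L1 L2 (lap v)) := by
  rw [L2sq, L2sq, ← intOn_add (f := fun p => lap u p ^ 2) (g := fun p => lap v p ^ 2)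
    ((continuous_lap hu).pow 2) ((continuous_lap hv).pow 2)]
  rfl

theorem intOn_gradSq_nonneg (L1 L2 : ℝ) (f : Pt → ℝ) : 0 ≤ intOn L1 L2 (gradSq f) :=
  intOn_nonneg (fun p => by unfold gradSq; positivity) _ _

/-- `L²` bounds for a periodic mean-zero function and its derivatives. -/
theorem L2n_bounds {L1 L2 G A : ℝ} (hL1 : 0 < L1) (hL2 : 0 < L2) {u : Pt → ℝ}
    (hu : ContDiff ℝ (⊤ : ℕ∞) u) (hp : SidePeriodic L1 L2 u)
    (hG : L2grad L1 L2 u ≤ G) (hA : L2n L1 L2 (lap u) ≤ A) :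
    (intOn L1 L2 u = 0 → L2n L1 L2 u ≤ (3 * (3 + L1 + L2)) ^ 2 * G ∧
      L2n L1 L2 u ≤ (3 * (3 + L1 + L2)) ^ 2 * A) ∧
    ∀ i, L2n L1 L2 (pd i u) ≤ (3 * (3 + L1 + L2)) ^ 2 * G ∧
      L2n L1 L2 (pd i u) ≤ (3 * (3 + L1 + L2)) ^ 2 * A ∧
      ∀ j, L2n L1 L2 (pd j (pd i u)) ≤ (3 * (3 + L1 + L2)) ^ 2 * A := by
  set k := 3 * (3 + L1 + L2) with hk
  have hk1 : 1 ≤ k := by linarith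
  have hG0 : 0 ≤ G := (Real.sqrt_nonneg _).trans hG
  have hA0 : 0 ≤ A := (Real.sqrt_nonneg _).trans hA
  have hkk : k ≤ k ^ 2 := by nlinarith
  have hGA : L2grad L1 L2 u ≤ k * A := (L2grad_le_lap hL1 hL2 hu hp).trans (by gcongr)
  refine ⟨fun h0 => ?_, fun i => ?_⟩
  · have h : L2n L1 L2 u ≤ k * L2grad L1 L2 u := L2n_le_grad hL1 hL2 hu h0
    constructor
    · exact h.trans (mul_le_mul hkk hG (Real.sqrt_nonneg _) (sq_nonneg _))
    · calc L2n L1 L2 u ≤ k * L2grad L1 L2 u := h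
        _ ≤ k * (k * A) := mul_le_mul_of_nonneg_left hGA (zero_le_one.trans hk1)
        _ = k ^ 2 * A := by ring
  · have h := L2n_pd_le_grad hu L1 L2 i
    refine ⟨?_, ?_, fun j => ?_⟩
    · nlinarith
    · nlinarith
    · have := L2n_pd_pd_le_lap hL1 hL2 hu hp j i
      nlinarith

/-- anisotropic trilinear estimate, Lemma 2.2. -/
theorem stmt_2 (L1 L2 : ℝ) (hL1 : 0 < L1) (hL2 : 0 < L2) :
    ∃ C > 0, ∀ (u1 u2 u3 phi ψ : Pt → ℝ),
      ContDiff ℝ (⊤ : ℕ∞) u1 → ContDiff ℝ (⊤ : ℕ∞) u2 → ContDiff ℝ (⊤ : ℕ∞) u3 →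
      ContDiff ℝ (⊤ : ℕ∞) phi → ContDiff ℝ (⊤ : ℕ∞) ψ →
      Periodic3 L1 L2 u1 → Periodic3 L1 L2 u2 → Periodic3 L1 L2 u3 →
      Periodic3 L1 L2 phi → Periodic3 L1 L2 ψ →
      (∀ p, pdx u1 p + pdy u2 p + pdz u3 p = 0) →
      intOn L1 L2 u1 = 0 → intOn L1 L2 u2 = 0 → intOn L1 L2 u3 = 0 →
      (∀ x y : ℝ, u3 (x, y, 0) = 0) →
      |∫ p in OmegaSet L1 L2,
          (u1 p * pdx phi p + u2 p * pdy phi p + u3 p * pdz phi p) * ψ p|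
        ≤ C * Real.sqrt (vGradn L1 L2 (fun p => (u1 p, u2 p)))
            * Real.sqrt (vLapn L1 L2 (fun p => (u1 p, u2 p)))
            * Real.sqrt (L2grad L1 L2 phi)
            * Real.sqrt (L2n L1 L2 (lap phi))
            * L2n L1 L2 ψ := by
  set K := (3 * (3 + L1 + L2)) ^ 2 with hKdef
  have hK : 0 < K := by positivity
  set M := K ^ 2 / L1 + K ^ 2 / L2 + 2 * K ^ 2 with hM
  refine ⟨9 * M, by positivity, ?_⟩
  intro u1 u2 u3 phi ψ h1 h2 h3 hphi hψ p1 p2 p3 pphi pψ hdiv m1 m2 _ hz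
  set G := vGradn L1 L2 (fun p => (u1 p, u2 p)) with hG
  set A := vLapn L1 L2 (fun p => (u1 p, u2 p)) with hA
  rw [vGradn_pair h1 h2] at hG
  rw [vLapn_pair h1 h2] at hA
  have hG0 : 0 ≤ G := Real.sqrt_nonneg _
  have hA0 : 0 ≤ A := Real.sqrt_nonneg _
  obtain ⟨b1, b1'⟩ := L2n_bounds (G := G) (A := A) hL1 hL2 h1 p1.sidePeriodic
    (by rw [hG]; exact Real.sqrt_le_sqrt (le_add_of_nonneg_right (intOn_gradSq_nonneg _ _ _)))
    (by rw [hA]; exact Real.sqrt_le_sqrt (le_add_of_nonneg_right (L2sq_nonneg _ _ _)))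
  obtain ⟨b2, b2'⟩ := L2n_bounds (G := G) (A := A) hL1 hL2 h2 p2.sidePeriodic
    (by rw [hG]; exact Real.sqrt_le_sqrt (le_add_of_nonneg_left (intOn_gradSq_nonneg _ _ _)))
    (by rw [hA]; exact Real.sqrt_le_sqrt (le_add_of_nonneg_left (L2sq_nonneg _ _ _)))
  have bphi := (L2n_bounds hL1 hL2 hphi pphi.sidePeriodic le_rfl le_rfl).2
  have c1 := h1.continuous
  have c2 := h2.continuous
  have c3 := h3.continuous
  have cψ := hψ.continuous
  have cphi : ∀ i, Continuous (pd i phi) := fun i => (contDiff_pd hphi i).continuous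
  have hterm {w a b : Pt → ℝ} (i : Fin 3) (hw : Continuous w) (ha : ContDiff ℝ (⊤ : ℕ∞) a)
      (hb : ContDiff ℝ (⊤ : ℕ∞) b) (hwab : ∀ p ∈ closedBox L1 L2,
        w p ^ 2 ≤ 4 * lineInt L1 L2 2 (fun q => a q ^ 2 + b q ^ 2) p)
      (haG : L2n L1 L2 a ≤ K * G) (haA : L2n L1 L2 a ≤ K * A)
      (hay : L2n L1 L2 (pd 1 a) ≤ K * A)
      (hbG : L2n L1 L2 b ≤ K * G) (hbA : L2n L1 L2 b ≤ K * A)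
      (hby : L2n L1 L2 (pd 1 b) ≤ K * A) :=
    abs_intOn_mul_mul_le (G' := L2grad L1 L2 phi) (A' := L2n L1 L2 (lap phi)) hL1 hL2 hw ha hb
      (contDiff_pd hphi i) cψ hwab hK.le hG0 hA0
      (Real.sqrt_nonneg _) (Real.sqrt_nonneg _) haG haA hay hbG hbA hby
      (bphi i).1 (bphi i).2.1 ((bphi i).2.2 0)
  have t1 := hterm 0 c1 h1 (contDiff_pd h1 2)
    (fun p hp => sq_le_lineInt_sq_add_sq_pd hL1 hL2 h1 hp)
    (b1 m1).1 (b1 m1).2 (b1' 1).2.1 (b1' 2).1 (b1' 2).2.1 ((b1' 2).2.2 1)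
  have t2 := hterm 1 c2 h2 (contDiff_pd h2 2)
    (fun p hp => sq_le_lineInt_sq_add_sq_pd hL1 hL2 h2 hp)
    (b2 m2).1 (b2 m2).2 (b2' 1).2.1 (b2' 2).1 (b2' 2).2.1 ((b2' 2).2.2 1)
  have t3 := hterm 2 c3 (contDiff_pd h1 0) (contDiff_pd h2 1)
    (fun p hp => sq_le_lineInt_of_pd_eq hL1 hL2 h3 (contDiff_pd h1 0).continuous
      (contDiff_pd h2 1).continuous hdiv hz hp)
    (b1' 0).1 (b1' 0).2.1 ((b1' 0).2.2 1) (b2' 1).1 (b2' 1).2.1 ((b2' 1).2.2 1)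
  have hsplit : (∫ p in OmegaSet L1 L2,
      (u1 p * pdx phi p + u2 p * pdy phi p + u3 p * pdz phi p) * ψ p) =
      intOn L1 L2 (fun p => u1 p * pd 0 phi p * ψ p) +
      intOn L1 L2 (fun p => u2 p * pd 1 phi p * ψ p) +
      intOn L1 L2 (fun p => u3 p * pd 2 phi p * ψ p) := by
    have d0 : Continuous (fun p => u1 p * pd 0 phi p * ψ p) := (c1.mul (cphi 0)).mul cψ
    have d1 : Continuous (fun p => u2 p * pd 1 phi p * ψ p) := (c2.mul (cphi 1)).mul cψ
    have d2 : Continuous (fun p => u3 p * pd 2 phi p * ψ p) := (c3.mul (cphi 2)).mul cψ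
    have d01 : Continuous (fun p => u1 p * pd 0 phi p * ψ p + u2 p * pd 1 phi p * ψ p) :=
      d0.add d1
    rw [← intOn_add d0 d1, ← intOn_add d01 d2, intOn]
    congr 1
    funext p
    rw [pd_zero, pd_one, pd_two]
    ring
  rw [hsplit]
  calc _ ≤ |intOn L1 L2 (fun p => u1 p * pd 0 phi p * ψ p)| +
        |intOn L1 L2 (fun p => u2 p * pd 1 phi p * ψ p)| +
        |intOn L1 L2 (fun p => u3 p * pd 2 phi p * ψ p)| := abs_add_three _ _ _
    _ ≤ _ := add_le_add (add_le_add t1 t2) t3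
    _ = _ := by
        rw [← hM]
        ring
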